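/- arXiv:2009.02804 — 3 statements merged into one kernel-verified Lean document; each statement's English description precedes it below -/
import Mathlib

section
/- Let a < b be real numbers, I = (a,b), I' = (0, b-a), let 0 < β < 1 and γ > 0, and let ϑ ∈ L²(I'). Then there exists a constant C such that for every f ∈ L₂(I,β,γ): ‖ x ↦ ∫_a^x ϑ(x-t) f(t) dt ‖_{L₂(I,β,γ)} ≤ C ‖f‖_{L₂(I,β,γ)}; that is, the operator I^ϑ_{a+} is bounded on L₂(I,β,γ). -/
open MeasureTheory Set Filter

/-- Normalizing constant of the orthonormal Jacobi polynomials. -/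
noncomputable def jacobiDelta (a b β γ : ℝ) (n : ℕ) : ℝ :=
  ((-1 : ℝ) ^ n / (b - a) ^ ((n : ℝ) + (β + γ + 1) / 2)) *
    Real.sqrt ((β + γ + 2 * n + 1) * Real.Gamma (β + γ + n + 1) /
      ((n.factorial : ℝ) * Real.Gamma (β + n + 1) * Real.Gamma (γ + n + 1)))

/-- Orthonormal Jacobi polynomial `p_n^{β,γ}` on `[a,b]`, given by the Rodrigues formula
(expanded via the Leibniz rule into a genuine polynomial expression). -/
noncomputable def jacobiP (a b β γ : ℝ) (n : ℕ) (x : ℝ) : ℝ :=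
  jacobiDelta a b β γ n *
    ∑ k ∈ Finset.range (n + 1),
      (-1 : ℝ) ^ (n - k) * (n.choose k : ℝ) *
        (∏ j ∈ Finset.range k, (β + n - j)) *
        (∏ j ∈ Finset.range (n - k), (γ + n - j)) *
        (x - a) ^ (n - k) * (b - x) ^ k

/-- The weight `ω^{β,γ}(x) = (x-a)^β (b-x)^γ`. -/
noncomputable def wgt (a b β γ : ℝ) (x : ℝ) : ℝ := (x - a) ^ β * (b - x) ^ γ

/-- Membership in the weighted Lebesgue space `L_p(I,β,γ)`, `I = (a,b)`. -/
def MemWLp (a b β γ p : ℝ) (f : ℝ → ℝ) : Prop :=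
  AEStronglyMeasurable f (volume.restrict (Ioo a b)) ∧
    ∫⁻ x in Ioo a b, ENNReal.ofReal (|f x| ^ p * wgt a b β γ x) < ⊤

/-- The norm of the weighted Lebesgue space `L_p(I,β,γ)`. -/
noncomputable def wLpNorm (a b β γ p : ℝ) (f : ℝ → ℝ) : ℝ :=
  (∫ x in Ioo a b, |f x| ^ p * wgt a b β γ x) ^ (1 / p)

/-- The left-sided Sonin-type integral operator `(I^ϱ_{a+} f)(x) = ∫_a^x ϱ(x-t) f(t) dt`. -/
noncomputable def soninI (a : ℝ) (ϱ f : ℝ → ℝ) (x : ℝ) : ℝ :=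
  ∫ t in a..x, ϱ (x - t) * f t

/-- The Sonin condition `(ϱ ∗ ϑ)(x) = 1` for a.e. `x ∈ (0, b-a)`. -/
def SoninCond (a b : ℝ) (ϱ ϑ : ℝ → ℝ) : Prop :=
  ∀ᵐ x ∂(volume.restrict (Ioo 0 (b - a))), ∫ t in (0 : ℝ)..x, ϱ (x - t) * ϑ t = 1

/-- The Jacobi coefficient `f^ϑ_n = ∫_a^b (I^ϑ_{a+}f)(x) p_n^{β-1,γ-1}(x) ω^{β-1,γ-1}(x) dx`. -/
noncomputable def soninCoef (a b β γ : ℝ) (ϑ f : ℝ → ℝ) (n : ℕ) : ℝ :=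
  ∫ x in Ioo a b, soninI a ϑ f x * jacobiP a b (β - 1) (γ - 1) n x * wgt a b (β - 1) (γ - 1) x

open scoped ENNReal

theorem sq_lintegral_mul_le {α : Type*} [MeasurableSpace α] (μ : Measure α) {f g : α → ℝ≥0∞}
    (hf : AEMeasurable f μ) (hg : AEMeasurable g μ) :
    (∫⁻ x, f x * g x ∂μ) ^ 2 ≤ (∫⁻ x, f x ^ 2 ∂μ) * ∫⁻ x, g x ^ 2 ∂μ := by
  have h := ENNReal.lintegral_mul_le_Lp_mul_Lq μ Real.HolderConjugate.two_two hf hg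
  simp only [Pi.mul_apply, ENNReal.rpow_two] at h
  refine (pow_le_pow_left' h 2).trans_eq ?_
  rw [mul_pow, ← ENNReal.rpow_two, ← ENNReal.rpow_two, ← ENNReal.rpow_mul, ← ENNReal.rpow_mul]
  norm_num

theorem lintegral_lintegral_sub_mul {G F : ℝ → ℝ≥0∞} (hG : AEMeasurable G) (hF : AEMeasurable F) :
    ∫⁻ x, ∫⁻ t, G (x - t) * F t = (∫⁻ s, G s) * ∫⁻ t, F t := by
  have hGsub : AEMeasurable (fun p : ℝ × ℝ => G (p.1 - p.2)) (volume.prod volume) :=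
    hG.comp_quasiMeasurePreserving (quasiMeasurePreserving_sub_of_right_invariant volume volume)
  rw [lintegral_lintegral_swap (hGsub.mul hF.comp_snd), ← lintegral_const_mul'' _ hF]
  refine lintegral_congr fun t => ?_
  have hGt : AEMeasurable (fun x => G (x - t)) := hG.comp_quasiMeasurePreserving
    (measurePreserving_sub_right volume t).quasiMeasurePreserving
  rw [lintegral_mul_const'' _ hGt, lintegral_sub_right_eq_self G t]

theorem wgt_pos {a b x : ℝ} (β γ : ℝ) (hx : x ∈ Ioo a b) : 0 < wgt a b β γ x :=
  mul_pos (Real.rpow_pos_of_pos (sub_pos.2 hx.1) _) (Real.rpow_pos_of_pos (sub_pos.2 hx.2) _)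

@[fun_prop]
theorem measurable_wgt (a b β γ : ℝ) : Measurable (wgt a b β γ) := by
  unfold wgt
  fun_prop

theorem lintegral_rpow_neg_sub_left {a x β : ℝ} (hax : a < x) (hβ : β < 1) :
    ∫⁻ t in Ioo a x, ENNReal.ofReal ((t - a) ^ (-β)) =
      ENNReal.ofReal ((x - a) ^ (1 - β) / (1 - β)) := by
  have hint : IntervalIntegrable (fun t : ℝ => (t - a) ^ (-β)) volume a x := by
    simpa using (intervalIntegral.intervalIntegrable_rpow' (a := 0) (b := x - a)
      (by linarith : -1 < -β)).comp_sub_right a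
  rw [← ofReal_integral_eq_lintegral_ofReal]
  · rw [← integral_Ioc_eq_integral_Ioo, ← intervalIntegral.integral_of_le hax.le,
      intervalIntegral.integral_comp_sub_right (fun t : ℝ => t ^ (-β)) a,
      integral_rpow (Or.inl (by linarith))]
    rw [sub_self, neg_add_eq_sub, Real.zero_rpow (by linarith), sub_zero]
  · exact ((intervalIntegrable_iff_integrableOn_Ioo_of_le hax.le).1 hint)
  · filter_upwards [ae_restrict_mem measurableSet_Ioo] with t ht
    exact Real.rpow_nonneg (sub_nonneg.2 ht.1.le) _

theorem lintegral_inv_wgt_mul_wgt_le {a b β γ x : ℝ} (hβ : β < 1) (hγ : 0 ≤ γ)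
    (hx : x ∈ Ioo a b) :
    (∫⁻ t in Ioo a x, ENNReal.ofReal (wgt a b β γ t)⁻¹) * ENNReal.ofReal (wgt a b β γ x) ≤
      ENNReal.ofReal ((b - a) / (1 - β)) := by
  have hxa : 0 < x - a := sub_pos.2 hx.1
  calc
    _ = ∫⁻ t in Ioo a x, ENNReal.ofReal (wgt a b β γ t)⁻¹ * ENNReal.ofReal (wgt a b β γ x) :=
      (lintegral_mul_const' _ _ ENNReal.ofReal_ne_top).symm
    _ ≤ ∫⁻ t in Ioo a x, ENNReal.ofReal ((t - a) ^ (-β)) * ENNReal.ofReal ((x - a) ^ β) := by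
      refine setLIntegral_mono' measurableSet_Ioo fun t ht => ?_
      have hta : 0 < t - a := sub_pos.2 ht.1
      have hbt : 0 < b - t := sub_pos.2 (ht.2.trans hx.2)
      have hmono : (b - x) ^ γ ≤ (b - t) ^ γ :=
        Real.rpow_le_rpow (sub_nonneg.2 hx.2.le) (by linarith [ht.2]) hγ
      rw [← ENNReal.ofReal_mul (inv_nonneg.2 (wgt_pos β γ ⟨ht.1, ht.2.trans hx.2⟩).le),
        ← ENNReal.ofReal_mul (Real.rpow_nonneg hta.le _)]
      refine ENNReal.ofReal_le_ofReal ?_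
      have htβ := Real.rpow_pos_of_pos hta β
      have htγ := Real.rpow_pos_of_pos hbt γ
      have hxβ := Real.rpow_pos_of_pos hxa β
      rw [wgt, wgt, Real.rpow_neg hta.le, inv_mul_eq_div, inv_mul_eq_div,
        mul_div_mul_comm]
      exact mul_le_of_le_one_right (by positivity) ((div_le_one htγ).2 hmono)
    _ = ENNReal.ofReal ((x - a) / (1 - β)) := by
      rw [lintegral_mul_const' _ _ ENNReal.ofReal_ne_top, lintegral_rpow_neg_sub_left hx.1 hβ,
        ← ENNReal.ofReal_mul (div_nonneg (Real.rpow_nonneg hxa.le _) (by linarith)),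
        div_mul_eq_mul_div, ← Real.rpow_add hxa, sub_add_cancel, Real.rpow_one]
    _ ≤ _ := ENNReal.ofReal_le_ofReal
      (div_le_div_of_nonneg_right (by linarith [hx.2]) (by linarith))

theorem enorm_soninI_sq_mul_wgt_le {a b β γ x : ℝ} {ϑ f : ℝ → ℝ} (hβ : β < 1) (hγ : 0 ≤ γ)
    (hϑ : AEStronglyMeasurable ϑ (volume.restrict (Ioo 0 (b - a))))
    (hf : AEStronglyMeasurable f (volume.restrict (Ioo a b))) (hx : x ∈ Ioo a b) :
    ‖soninI a ϑ f x‖ₑ ^ 2 * ENNReal.ofReal (wgt a b β γ x) ≤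
      ENNReal.ofReal ((b - a) / (1 - β)) *
        ∫⁻ t in Ioo a x, ‖ϑ (x - t)‖ₑ ^ 2 * (‖f t‖ₑ ^ 2 * ENNReal.ofReal (wgt a b β γ t)) := by
  have hϑx : AEMeasurable (fun t => ‖ϑ (x - t)‖ₑ) (volume.restrict (Ioo a x)) := by
    have hmp := (Measure.measurePreserving_sub_left volume x).restrict_preimage
      (measurableSet_Ioo (a := (0 : ℝ)) (b := x - a))
    rw [preimage_const_sub_Ioo, sub_zero, sub_sub_cancel] at hmp
    exact ((hϑ.mono_measure (Measure.restrict_mono (Ioo_subset_Ioo_right (by linarith [hx.2]))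
      le_rfl)).enorm).comp_quasiMeasurePreserving hmp.quasiMeasurePreserving
  have hfx : AEMeasurable (fun t => ‖f t‖ₑ) (volume.restrict (Ioo a x)) :=
    (hf.mono_measure (Measure.restrict_mono (Ioo_subset_Ioo_right hx.2.le) le_rfl)).enorm
  have hwgt {t : ℝ} (ht : t ∈ Ioo a x) : 0 < wgt a b β γ t :=
    wgt_pos β γ ⟨ht.1, ht.2.trans hx.2⟩
  have hbound : ‖soninI a ϑ f x‖ₑ ≤ ∫⁻ t in Ioo a x, ENNReal.ofReal (√(wgt a b β γ t)⁻¹) *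
      (‖ϑ (x - t)‖ₑ * (‖f t‖ₑ * ENNReal.ofReal √(wgt a b β γ t))) := by
    rw [soninI, intervalIntegral.integral_of_le hx.1.le, integral_Ioc_eq_integral_Ioo]
    refine (enorm_integral_le_lintegral_enorm _).trans_eq
      (setLIntegral_congr_fun measurableSet_Ioo fun t ht => ?_)
    have hone : ENNReal.ofReal (√(wgt a b β γ t)⁻¹) * ENNReal.ofReal √(wgt a b β γ t) = 1 := by
      rw [← ENNReal.ofReal_mul (Real.sqrt_nonneg _), Real.sqrt_inv,
        inv_mul_cancel₀ (Real.sqrt_pos.2 (hwgt ht)).ne', ENNReal.ofReal_one]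
    simp only [enorm_mul]
    rw [← mul_assoc ‖ϑ (x - t)‖ₑ, mul_left_comm, hone, mul_one]
  have hsq {y : ℝ} (hy : 0 ≤ y) : ENNReal.ofReal √y ^ 2 = ENNReal.ofReal y := by
    rw [← ENNReal.ofReal_pow (Real.sqrt_nonneg _), Real.sq_sqrt hy]
  calc
    _ ≤ ((∫⁻ t in Ioo a x, ENNReal.ofReal (wgt a b β γ t)⁻¹) *
        ∫⁻ t in Ioo a x, ‖ϑ (x - t)‖ₑ ^ 2 * (‖f t‖ₑ ^ 2 * ENNReal.ofReal (wgt a b β γ t))) *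
          ENNReal.ofReal (wgt a b β γ x) := by
      gcongr
      refine (pow_le_pow_left' hbound 2).trans ((sq_lintegral_mul_le _ (by fun_prop)
        (hϑx.mul (hfx.mul (by fun_prop)))).trans_eq ?_)
      congr 1
      · refine setLIntegral_congr_fun measurableSet_Ioo fun t ht => ?_
        exact hsq (inv_nonneg.2 (hwgt ht).le)
      · refine setLIntegral_congr_fun measurableSet_Ioo fun t ht => ?_
        simp only [Pi.mul_apply, mul_pow, hsq (hwgt ht).le]
    _ ≤ _ := by
      rw [mul_right_comm]
      gcongr
      exact lintegral_inv_wgt_mul_wgt_le hβ hγ hx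

theorem lintegral_soninI_sq_mul_wgt_le {a b β γ : ℝ} {ϑ f : ℝ → ℝ} (hβ : β < 1) (hγ : 0 ≤ γ)
    (hϑ : AEStronglyMeasurable ϑ (volume.restrict (Ioo 0 (b - a))))
    (hf : AEStronglyMeasurable f (volume.restrict (Ioo a b))) :
    ∫⁻ x in Ioo a b, ‖soninI a ϑ f x‖ₑ ^ 2 * ENNReal.ofReal (wgt a b β γ x) ≤
      ENNReal.ofReal ((b - a) / (1 - β)) * ((∫⁻ t in Ioo 0 (b - a), ‖ϑ t‖ₑ ^ 2) *
        ∫⁻ t in Ioo a b, ‖f t‖ₑ ^ 2 * ENNReal.ofReal (wgt a b β γ t)) := by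
  set G := (Ioo 0 (b - a)).indicator fun t => ‖ϑ t‖ₑ ^ 2 with hG
  set F := (Ioo a b).indicator fun t => ‖f t‖ₑ ^ 2 * ENNReal.ofReal (wgt a b β γ t) with hF
  have hGm : AEMeasurable G :=
    (aemeasurable_indicator_iff measurableSet_Ioo).2 (hϑ.enorm.pow_const 2)
  have hFm : AEMeasurable F :=
    (aemeasurable_indicator_iff measurableSet_Ioo).2 ((hf.enorm.pow_const 2).mul (by fun_prop))
  calc
    _ ≤ ∫⁻ x in Ioo a b, ENNReal.ofReal ((b - a) / (1 - β)) * ∫⁻ t, G (x - t) * F t := by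
      refine setLIntegral_mono' measurableSet_Ioo fun x hx =>
        (enorm_soninI_sq_mul_wgt_le hβ hγ hϑ hf hx).trans ?_
      refine mul_le_mul_right (le_trans (le_of_eq (setLIntegral_congr_fun measurableSet_Ioo
        fun t ht => ?_)) (setLIntegral_le_lintegral (Ioo a x) _)) _
      have hxt : x - t ∈ Ioo 0 (b - a) := ⟨by linarith [ht.2], by linarith [ht.1, hx.2]⟩
      have ht' : t ∈ Ioo a b := ⟨ht.1, ht.2.trans hx.2⟩
      simp only [hG, hF, indicator_of_mem hxt, indicator_of_mem ht']
    _ ≤ ENNReal.ofReal ((b - a) / (1 - β)) * ∫⁻ x, ∫⁻ t, G (x - t) * F t := by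
      rw [lintegral_const_mul' _ _ ENNReal.ofReal_ne_top]
      exact mul_le_mul_right (setLIntegral_le_lintegral _ _) _
    _ = _ := by
      rw [lintegral_lintegral_sub_mul hGm hFm, hG, hF, lintegral_indicator measurableSet_Ioo,
        lintegral_indicator measurableSet_Ioo]

theorem ofReal_abs_rpow_two_mul (y w : ℝ) :
    ENNReal.ofReal (|y| ^ (2 : ℝ) * w) = ‖y‖ₑ ^ 2 * ENNReal.ofReal w := by
  rw [Real.rpow_two, ENNReal.ofReal_mul (sq_nonneg _), ENNReal.ofReal_pow (abs_nonneg y),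
    Real.enorm_eq_ofReal_abs]

theorem integral_le_toReal_lintegral_ofReal {α : Type*} [MeasurableSpace α] {μ : Measure α}
    {f : α → ℝ} (hf : 0 ≤ᵐ[μ] f) : ∫ x, f x ∂μ ≤ (∫⁻ x, ENNReal.ofReal (f x) ∂μ).toReal := by
  by_cases hfi : Integrable f μ
  · exact (integral_eq_lintegral_of_nonneg_ae hf hfi.aestronglyMeasurable).le
  · rw [integral_undef hfi]
    exact ENNReal.toReal_nonneg

theorem abs_rpow_mul_wgt_nonneg_ae (a b β γ p : ℝ) (f : ℝ → ℝ) :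
    0 ≤ᵐ[volume.restrict (Ioo a b)] fun x => |f x| ^ p * wgt a b β γ x := by
  filter_upwards [ae_restrict_mem measurableSet_Ioo] with x hx
  exact mul_nonneg (Real.rpow_nonneg (abs_nonneg _) _) (wgt_pos β γ hx).le

/-- Lemma 3: `I^ϑ_{a+}` is bounded on `L₂(I,β,γ)` for `ϑ ∈ L²(I')`. -/
theorem sonin_operator_bounded_L2
    (a b β γ : ℝ) (ϑ : ℝ → ℝ)
    (hab : a < b) (hβ0 : 0 < β) (hβ1 : β < 1) (hγ : 0 < γ)
    (hϑmeas : AEStronglyMeasurable ϑ (volume.restrict (Ioo 0 (b - a))))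
    (hϑ2 : IntegrableOn (fun t => ϑ t ^ 2) (Ioo 0 (b - a))) :
    ∃ C : ℝ, ∀ f : ℝ → ℝ, MemWLp a b β γ 2 f →
      wLpNorm a b β γ 2 (soninI a ϑ f) ≤ C * wLpNorm a b β γ 2 f := by
  set T := ∫⁻ t in Ioo 0 (b - a), ‖ϑ t‖ₑ ^ 2 with hT
  have hTtop : T ≠ ⊤ := by
    refine ne_of_lt (lt_of_eq_of_lt (lintegral_congr fun t => ?_) hϑ2.2)
    rw [enorm_pow]
  refine ⟨((b - a) / (1 - β) * T.toReal) ^ (1 / 2 : ℝ), fun f ⟨hfm, hfint⟩ => ?_⟩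
  have hK : 0 ≤ (b - a) / (1 - β) := div_nonneg (by linarith) (by linarith)
  have hfeq : ∫ x in Ioo a b, |f x| ^ (2 : ℝ) * wgt a b β γ x =
      (∫⁻ x in Ioo a b, ENNReal.ofReal (|f x| ^ (2 : ℝ) * wgt a b β γ x)).toReal :=
    integral_eq_lintegral_of_nonneg_ae (abs_rpow_mul_wgt_nonneg_ae a b β γ 2 f)
      (((hfm.aemeasurable.norm.pow_const 2).mul (by fun_prop)).aestronglyMeasurable)
  have hle := lintegral_soninI_sq_mul_wgt_le hβ1 hγ.le hϑmeas hfm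
  simp only [← ofReal_abs_rpow_two_mul] at hle
  rw [wLpNorm, wLpNorm, ← Real.mul_rpow (mul_nonneg hK ENNReal.toReal_nonneg)
    (integral_nonneg_of_ae (abs_rpow_mul_wgt_nonneg_ae a b β γ 2 f))]
  refine Real.rpow_le_rpow (integral_nonneg_of_ae (abs_rpow_mul_wgt_nonneg_ae a b β γ 2 _)) ?_
    (by norm_num)
  calc
    _ ≤ _ := integral_le_toReal_lintegral_ofReal (abs_rpow_mul_wgt_nonneg_ae a b β γ 2 _)
    _ ≤ _ := ENNReal.toReal_mono (ENNReal.mul_ne_top ENNReal.ofReal_ne_top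
      (ENNReal.mul_ne_top hTtop hfint.ne)) hle
    _ = _ := by
      rw [hfeq, ENNReal.toReal_mul, ENNReal.toReal_mul, ENNReal.toReal_ofReal hK, mul_assoc]
end

section
/- Let a < b be real numbers, I = (a,b), I' = (0, b-a), let 1 < p < 2, p' = p/(p-1), and let 0 < β, γ < p - 1. Let ϱ ∈ L^{p'}(I'). Then there exists a constant C such that for every f ∈ L_p(I,β,γ): ‖ x ↦ ∫_a^x ϱ(x-t) f(t) dt ‖_{L₂(I,β,γ)} ≤ C ‖f‖_{L_p(I,β,γ)}. -/
open MeasureTheory Set Filter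

open scoped ENNReal

theorem lintegral_conv_sq_le {R G : ℝ → ℝ≥0∞} (hR : Measurable R) (hG : Measurable G) :
    ∫⁻ x, (∫⁻ t, R (x - t) * G t) ^ (2 : ℝ) ≤
      (∫⁻ s, R s ^ (2 : ℝ)) * (∫⁻ t, G t) ^ (2 : ℝ) := by
  have cauchy (x : ℝ) : (∫⁻ t, R (x - t) * G t) ^ (2 : ℝ) ≤
      (∫⁻ t, R (x - t) ^ (2 : ℝ) * G t) * ∫⁻ t, G t := by
    have h := ENNReal.lintegral_mul_norm_pow_le (μ := volume)
      (f := fun t => R (x - t) ^ (2 : ℝ) * G t) (g := G) (p := 1 / 2) (q := 1 / 2)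
      (by fun_prop) hG.aemeasurable (by norm_num) (by norm_num) (by norm_num)
    have hpt (t : ℝ) :
        (R (x - t) ^ (2 : ℝ) * G t) ^ (1 / 2 : ℝ) * G t ^ (1 / 2 : ℝ) = R (x - t) * G t := by
      rw [ENNReal.mul_rpow_of_nonneg _ _ (by norm_num), ← ENNReal.rpow_mul, mul_assoc,
        ← ENNReal.rpow_add_of_nonneg _ _ (by norm_num) (by norm_num)]
      norm_num
    simp only [hpt] at h
    calc _ ≤ _ := ENNReal.rpow_le_rpow h (by norm_num)
      _ = _ := by
        rw [ENNReal.mul_rpow_of_nonneg _ _ (by norm_num), ← ENNReal.rpow_mul,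
          ← ENNReal.rpow_mul]
        norm_num
  calc ∫⁻ x, (∫⁻ t, R (x - t) * G t) ^ (2 : ℝ)
      ≤ ∫⁻ x, (∫⁻ t, R (x - t) ^ (2 : ℝ) * G t) * ∫⁻ t, G t := lintegral_mono cauchy
    _ = (∫⁻ x, ∫⁻ t, R (x - t) ^ (2 : ℝ) * G t) * ∫⁻ t, G t :=
        lintegral_mul_const _ (Measurable.lintegral_prod_right' (f := fun z : ℝ × ℝ =>
          R (z.1 - z.2) ^ (2 : ℝ) * G z.2) (by fun_prop))
    _ = (∫⁻ t, ∫⁻ x, R (x - t) ^ (2 : ℝ) * G t) * ∫⁻ t, G t := by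
        rw [lintegral_lintegral_swap]
        exact Measurable.aemeasurable (by unfold Function.uncurry; fun_prop)
    _ = (∫⁻ s, R s ^ (2 : ℝ)) * (∫⁻ t, G t) ^ (2 : ℝ) := by
        have inner (t : ℝ) : ∫⁻ x, R (x - t) ^ (2 : ℝ) * G t =
            (∫⁻ s, R s ^ (2 : ℝ)) * G t := by
          rw [lintegral_mul_const _ (by fun_prop),
            lintegral_sub_right_eq_self (fun s => R s ^ (2 : ℝ)) t]
        simp only [inner]
        rw [lintegral_const_mul _ hG, mul_assoc, ENNReal.rpow_two, sq]

theorem enorm_soninIntegral_le {a b x : ℝ} {ϱ f : ℝ → ℝ} (hx : x ∈ Ioo a b) {R G : ℝ → ℝ≥0∞}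
    (hR : (Ioo 0 (b - a)).indicator (fun s => ‖ϱ s‖ₑ) =ᵐ[volume] R)
    (hG : (Ioo a b).indicator (fun t => ‖f t‖ₑ) =ᵐ[volume] G) :
    ‖∫ t in a..x, ϱ (x - t) * f t‖ₑ ≤ ∫⁻ t, R (x - t) * G t := by
  rw [intervalIntegral.integral_of_le hx.1.le, integral_Ioc_eq_integral_Ioo]
  refine (enorm_integral_le_lintegral_enorm _).trans ?_
  rw [← lintegral_indicator measurableSet_Ioo]
  have hR' := (Measure.measurePreserving_sub_left (volume : Measure ℝ) x).quasiMeasurePreserving.ae hR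
  refine lintegral_mono_ae ?_
  filter_upwards [hR', hG] with t h1 h2
  rw [← h1, ← h2]
  by_cases ht : t ∈ Ioo a x
  swap
  · simp [ht]
  have hxt : x - t ∈ Ioo 0 (b - a) := ⟨by linarith [ht.2], by linarith [ht.1, hx.2]⟩
  have htb : t ∈ Ioo a b := ⟨ht.1, ht.2.trans hx.2⟩
  rw [indicator_of_mem ht, indicator_of_mem hxt, indicator_of_mem htb, enorm_mul]

theorem integrableOn_sub_rpow_mul_sub_rpow {a b s t : ℝ} (hab : a < b)
    (hs0 : s ≤ 0) (hs : -1 < s) (ht0 : t ≤ 0) (ht : -1 < t) :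
    IntegrableOn (fun x => (x - a) ^ s * (b - x) ^ t) (Ioo a b) := by
  have hL : 0 < (b - a) / 2 := by linarith
  have h1 : IntegrableOn (fun x => (x - a) ^ s) (Ioo a b) := by
    have := (intervalIntegral.intervalIntegrable_rpow' (a := 0) (b := b - a) hs).comp_sub_right a
    rw [zero_add, sub_add_cancel] at this
    exact (intervalIntegrable_iff_integrableOn_Ioo_of_le hab.le).1 this
  have h2 : IntegrableOn (fun x => (b - x) ^ t) (Ioo a b) := by
    have := (intervalIntegral.intervalIntegrable_rpow' (a := 0) (b := b - a) ht).comp_sub_left b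
    rw [sub_zero, sub_sub_cancel] at this
    exact (intervalIntegrable_iff_integrableOn_Ioo_of_le hab.le).1 this.symm
  refine ((h1.mul_const (((b - a) / 2) ^ t)).add (h2.const_mul (((b - a) / 2) ^ s))).mono'
    (h1.aestronglyMeasurable.mul h2.aestronglyMeasurable) ?_
  filter_upwards [ae_restrict_mem measurableSet_Ioo] with x hx
  have hxa : 0 < x - a := by linarith [hx.1]
  have hbx : 0 < b - x := by linarith [hx.2]
  have p1 := Real.rpow_nonneg hxa.le s
  have p2 := Real.rpow_nonneg hbx.le t
  rw [Real.norm_of_nonneg (by positivity)]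
  simp only [Pi.add_apply]
  rcases le_total ((b - a) / 2) (x - a) with h | h
  · have := Real.rpow_le_rpow_of_nonpos hL h hs0
    have := mul_le_mul_of_nonneg_right this p2
    have : 0 ≤ (x - a) ^ s * ((b - a) / 2) ^ t := by positivity
    linarith
  · have := Real.rpow_le_rpow_of_nonpos hL (show (b - a) / 2 ≤ b - x by linarith) ht0
    have := mul_le_mul_of_nonneg_left this p1
    have : 0 ≤ ((b - a) / 2) ^ s * (b - x) ^ t := by positivity
    linarith

theorem lintegral_enorm_sq_lt_top_of_integrable_rpow {α : Type*} [MeasurableSpace α]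
    {μ : Measure α} [IsFiniteMeasure μ] {ϱ : α → ℝ} {q : ℝ} (hq : 2 ≤ q)
    (h : Integrable (fun t => |ϱ t| ^ q) μ) : ∫⁻ t, ‖ϱ t‖ₑ ^ (2 : ℝ) ∂μ < ∞ := by
  refine lt_of_le_of_lt (lintegral_mono fun t => ?_) ((integrable_const (1 : ℝ)).add h).2
  rw [Real.enorm_eq_ofReal_abs, ENNReal.ofReal_rpow_of_nonneg (abs_nonneg _) (by norm_num)]
  rw [Real.enorm_eq_ofReal_abs]
  refine ENNReal.ofReal_le_ofReal (le_trans ?_ (le_abs_self _))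
  simp only [Pi.add_apply]
  rcases le_total |ϱ t| 1 with h | h
  · have h1 := Real.rpow_le_one (abs_nonneg (ϱ t)) h (show (0 : ℝ) ≤ 2 by norm_num)
    have : 0 ≤ |ϱ t| ^ q := by positivity
    linarith
  · have := Real.rpow_le_rpow_of_exponent_le h hq
    linarith

theorem aemeasurable_abs_rpow_mul_wgt {a b β γ p : ℝ} {f : ℝ → ℝ}
    (hf : AEStronglyMeasurable f (volume.restrict (Ioo a b))) :
    AEMeasurable (fun x => |f x| ^ p * wgt a b β γ x) (volume.restrict (Ioo a b)) :=
  AEMeasurable.mul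
    ((_root_.continuous_abs.measurable.comp_aemeasurable hf.aemeasurable).pow_const p)
    (by unfold wgt; fun_prop)

theorem lintegral_enorm_le_weighted {a b β γ p : ℝ} (hp : 1 < p) {f : ℝ → ℝ}
    (hf : AEStronglyMeasurable f (volume.restrict (Ioo a b))) :
    ∫⁻ x in Ioo a b, ‖f x‖ₑ ≤
      (∫⁻ x in Ioo a b, ENNReal.ofReal (|f x| ^ p * wgt a b β γ x)) ^ (1 / p) *
      (∫⁻ x in Ioo a b, ENNReal.ofReal
        ((x - a) ^ (-(β / (p - 1))) * (b - x) ^ (-(γ / (p - 1))))) ^ ((p - 1) / p) := by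
  have hp0 : 0 < p := by linarith
  have hp1 : 0 < p - 1 := by linarith
  refine le_trans (lintegral_mono_ae ?_) (ENNReal.lintegral_mul_norm_pow_le
    (aemeasurable_abs_rpow_mul_wgt hf).ennreal_ofReal (by fun_prop) (by positivity) (by positivity)
    (by field_simp; ring))
  filter_upwards [ae_restrict_mem measurableSet_Ioo] with x hx
  have hxa : 0 < x - a := by linarith [hx.1]
  have hbx : 0 < b - x := by linarith [hx.2]
  have hw : 0 < wgt a b β γ x := by unfold wgt; positivity
  have hv : (x - a) ^ (-(β / (p - 1))) * (b - x) ^ (-(γ / (p - 1))) =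
      wgt a b β γ x ^ (-(1 / (p - 1))) := by
    unfold wgt
    rw [Real.mul_rpow (by positivity) (by positivity), ← Real.rpow_mul hxa.le,
      ← Real.rpow_mul hbx.le]
    congr 2 <;> ring
  rw [hv, ENNReal.ofReal_rpow_of_nonneg (by positivity) (by positivity),
    ENNReal.ofReal_rpow_of_nonneg (by positivity) (by positivity),
    ← ENNReal.ofReal_mul (by positivity), Real.mul_rpow (by positivity) hw.le,
    ← Real.rpow_mul (abs_nonneg _), ← Real.rpow_mul hw.le, mul_assoc, ← Real.rpow_add hw,
    Real.enorm_eq_ofReal_abs]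
  refine ENNReal.ofReal_le_ofReal (le_of_eq ?_)
  have e1 : p * (1 / p) = 1 := by field_simp
  have e2 : 1 / p + -(1 / (p - 1)) * ((p - 1) / p) = 0 := by field_simp; ring
  rw [e1, e2, Real.rpow_one, Real.rpow_zero, mul_one]

theorem lintegral_soninI_sq_le {a b : ℝ} {ϱ f : ℝ → ℝ}
    (hϱ : AEStronglyMeasurable ϱ (volume.restrict (Ioo 0 (b - a))))
    (hf : AEStronglyMeasurable f (volume.restrict (Ioo a b))) :
    ∫⁻ x in Ioo a b, ‖soninI a ϱ f x‖ₑ ^ (2 : ℝ) ≤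
      (∫⁻ s in Ioo 0 (b - a), ‖ϱ s‖ₑ ^ (2 : ℝ)) * (∫⁻ t in Ioo a b, ‖f t‖ₑ) ^ (2 : ℝ) := by
  have hR := (aemeasurable_indicator_iff (measurableSet_Ioo (a := 0) (b := b - a))).2 hϱ.enorm
  have hG := (aemeasurable_indicator_iff (measurableSet_Ioo (a := a) (b := b))).2 hf.enorm
  calc ∫⁻ x in Ioo a b, ‖soninI a ϱ f x‖ₑ ^ (2 : ℝ)
      ≤ ∫⁻ x in Ioo a b, (∫⁻ t, hR.mk _ (x - t) * hG.mk _ t) ^ (2 : ℝ) :=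
        setLIntegral_mono_ae' measurableSet_Ioo (ae_of_all _ fun x hx =>
          ENNReal.rpow_le_rpow (enorm_soninIntegral_le hx hR.ae_eq_mk hG.ae_eq_mk) (by norm_num))
    _ ≤ ∫⁻ x, (∫⁻ t, hR.mk _ (x - t) * hG.mk _ t) ^ (2 : ℝ) := setLIntegral_le_lintegral _ _
    _ ≤ _ := lintegral_conv_sq_le hR.measurable_mk hG.measurable_mk
    _ = _ := by
        congr 1
        · rw [← lintegral_indicator measurableSet_Ioo]
          refine lintegral_congr_ae ?_
          filter_upwards [hR.ae_eq_mk] with s hs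
          rw [← hs]
          by_cases h : s ∈ Ioo 0 (b - a) <;> simp [h]
        · rw [← lintegral_indicator measurableSet_Ioo, lintegral_congr_ae hG.ae_eq_mk]

theorem wgt_le {a b β γ x : ℝ} (hβ : 0 ≤ β) (hγ : 0 ≤ γ) (hx : x ∈ Ioo a b) :
    wgt a b β γ x ≤ (b - a) ^ β * (b - a) ^ γ := by
  have hxa : 0 ≤ x - a := by linarith [hx.1]
  have hbx : 0 ≤ b - x := by linarith [hx.2]
  have hba : 0 ≤ b - a := by linarith
  exact mul_le_mul (Real.rpow_le_rpow hxa (by linarith) hβ)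
    (Real.rpow_le_rpow hbx (by linarith) hγ) (by positivity) (by positivity)

theorem wgt_nonneg {a b β γ x : ℝ} (hx : x ∈ Ioo a b) : 0 ≤ wgt a b β γ x :=
  mul_nonneg (Real.rpow_nonneg (by linarith [hx.1]) _) (Real.rpow_nonneg (by linarith [hx.2]) _)

/-- `I^ϱ_{a+}` maps `L_p(I,β,γ)` into `L₂(I,β,γ)` boundedly for
`ϱ ∈ L^{p'}(I')`, `p' = p/(p-1)`. -/
theorem sonin_operator_bounded_Lp_to_L2
    (a b β γ p : ℝ) (ϱ : ℝ → ℝ)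
    (hab : a < b) (hp1 : 1 < p) (hp2 : p < 2)
    (hβ0 : 0 < β) (hβp : β < p - 1) (hγ0 : 0 < γ) (hγp : γ < p - 1)
    (hϱmeas : AEStronglyMeasurable ϱ (volume.restrict (Ioo 0 (b - a))))
    (hϱp' : IntegrableOn (fun t => |ϱ t| ^ (p / (p - 1))) (Ioo 0 (b - a))) :
    ∃ C : ℝ, ∀ f : ℝ → ℝ, MemWLp a b β γ p f →
      wLpNorm a b β γ 2 (soninI a ϱ f) ≤ C * wLpNorm a b β γ p f := by
  set K := ∫⁻ x in Ioo a b, ENNReal.ofReal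
    ((x - a) ^ (-(β / (p - 1))) * (b - x) ^ (-(γ / (p - 1)))) with hK
  set A := ∫⁻ s in Ioo 0 (b - a), ‖ϱ s‖ₑ ^ (2 : ℝ) with hA
  set W := (b - a) ^ β * (b - a) ^ γ with hWdef
  have hp0 : 0 < p - 1 := by linarith
  have hβ1 : β / (p - 1) < 1 := (div_lt_one hp0).2 hβp
  have hγ1 : γ / (p - 1) < 1 := (div_lt_one hp0).2 hγp
  have hβ2 : 0 < β / (p - 1) := by positivity
  have hγ2 : 0 < γ / (p - 1) := by positivity
  have hKtop : K ≠ ∞ :=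
    ((integrableOn_sub_rpow_mul_sub_rpow hab (by linarith) (by linarith) (by linarith)
      (by linarith)).lintegral_lt_top).ne
  have hAtop : A ≠ ∞ := (lintegral_enorm_sq_lt_top_of_integrable_rpow
    (by rw [le_div_iff₀ hp0]; linarith) hϱp').ne
  have hba : 0 < b - a := by linarith
  have hW : 0 ≤ W := by positivity
  refine ⟨(ENNReal.ofReal W * A).toReal ^ (1 / 2 : ℝ) * (K ^ ((p - 1) / p)).toReal, fun f hf => ?_⟩
  have hfint : Integrable (fun x => |f x| ^ p * wgt a b β γ x) (volume.restrict (Ioo a b)) := by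
    refine ⟨(aemeasurable_abs_rpow_mul_wgt hf.1).aestronglyMeasurable,
      lt_of_le_of_lt (lintegral_mono_ae ?_) hf.2⟩
    filter_upwards [ae_restrict_mem measurableSet_Ioo] with x hx
    rw [Real.enorm_of_nonneg (mul_nonneg (by positivity) (wgt_nonneg hx))]
  have hF0 : 0 ≤ᵐ[volume.restrict (Ioo a b)] fun x => |f x| ^ p * wgt a b β γ x := by
    filter_upwards [ae_restrict_mem measurableSet_Ioo] with x hx
    exact mul_nonneg (by positivity) (wgt_nonneg hx)
  have hN : 0 ≤ wLpNorm a b β γ p f := Real.rpow_nonneg (integral_nonneg_of_ae hF0) _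
  have hL1 : ∫⁻ x in Ioo a b, ‖f x‖ₑ ≤
      ENNReal.ofReal (wLpNorm a b β γ p f) * K ^ ((p - 1) / p) := by
    refine (lintegral_enorm_le_weighted (β := β) (γ := γ) hp1 hf.1).trans (le_of_eq ?_)
    rw [wLpNorm, ← ENNReal.ofReal_rpow_of_nonneg (integral_nonneg_of_ae hF0) (by positivity),
      ofReal_integral_eq_lintegral_ofReal hfint hF0]
  have hmain : ∫⁻ x in Ioo a b, ENNReal.ofReal ‖|soninI a ϱ f x| ^ (2 : ℝ) * wgt a b β γ x‖ ≤
      ENNReal.ofReal W * A *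
        (ENNReal.ofReal (wLpNorm a b β γ p f) * K ^ ((p - 1) / p)) ^ (2 : ℝ) := by
    calc _ ≤ ∫⁻ x in Ioo a b, ENNReal.ofReal W * ‖soninI a ϱ f x‖ₑ ^ (2 : ℝ) := by
          refine setLIntegral_mono_ae' measurableSet_Ioo (ae_of_all _ fun x hx => ?_)
          rw [Real.norm_of_nonneg (mul_nonneg (by positivity) (wgt_nonneg hx)), mul_comm,
            ENNReal.ofReal_mul (wgt_nonneg hx), Real.enorm_eq_ofReal_abs,
            ENNReal.ofReal_rpow_of_nonneg (abs_nonneg _) (by norm_num)]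
          gcongr
          exact wgt_le hβ0.le hγ0.le hx
      _ = ENNReal.ofReal W * ∫⁻ x in Ioo a b, ‖soninI a ϱ f x‖ₑ ^ (2 : ℝ) :=
          lintegral_const_mul' _ _ ENNReal.ofReal_ne_top
      _ ≤ _ := by
          rw [mul_assoc]
          gcongr
          exact (lintegral_soninI_sq_le hϱmeas hf.1).trans (by gcongr)
  have hreal : ∫ x in Ioo a b, |soninI a ϱ f x| ^ (2 : ℝ) * wgt a b β γ x ≤
      (ENNReal.ofReal W * A).toReal *
        (wLpNorm a b β γ p f * (K ^ ((p - 1) / p)).toReal) ^ (2 : ℝ) := by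
    have hKp : K ^ ((p - 1) / p) ≠ ∞ := ENNReal.rpow_ne_top_of_nonneg (by positivity) hKtop
    refine (Real.le_norm_self _).trans ((norm_integral_le_lintegral_norm _).trans
      ((ENNReal.toReal_mono ?_ hmain).trans (le_of_eq ?_)))
    · exact ENNReal.mul_ne_top (ENNReal.mul_ne_top ENNReal.ofReal_ne_top hAtop)
        (ENNReal.rpow_ne_top_of_nonneg (by norm_num)
          (ENNReal.mul_ne_top ENNReal.ofReal_ne_top hKp))
    · rw [ENNReal.toReal_mul, ← ENNReal.toReal_rpow, ENNReal.toReal_mul (a := ENNReal.ofReal _)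
        (b := K ^ _), ENNReal.toReal_ofReal hN]
  have hI0 : 0 ≤ ∫ x in Ioo a b, |soninI a ϱ f x| ^ (2 : ℝ) * wgt a b β γ x :=
    setIntegral_nonneg measurableSet_Ioo fun x hx => mul_nonneg (by positivity) (wgt_nonneg hx)
  refine (Real.rpow_le_rpow hI0 hreal (by norm_num : (0 : ℝ) ≤ 1 / 2)).trans (le_of_eq ?_)
  rw [Real.mul_rpow ENNReal.toReal_nonneg (by positivity), ← Real.rpow_mul (by positivity)]
  norm_num
  ring
end

section
/- Let a < b be real numbers, I = (a,b), I' = (0, b-a), and let ϱ, ϑ ∈ L¹(I') satisfy the Sonin condition. Then for every φ ∈ L¹(I) and almost every x ∈ I: ∫_a^x ϑ(x-t) ( ∫_a^t ϱ(t-s) φ(s) ds ) dt = ∫_a^x φ(s) ds. Consequently the function x ↦ ∫_a^x ϑ(x-t) (I^ϱ_{a+}φ)(t) dt coincides a.e. with an absolutely continuous function whose derivative equals φ almost everywhere, i.e. D^ϑ_{a+} I^ϱ_{a+} φ = φ a.e. -/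
open MeasureTheory Set Filter

open scoped Convolution

/-- The convolution of two functions vanishing on `(-∞, 0]` and `(-∞, a]` is a Volterra integral. -/
lemma convolution_eq_intervalIntegral {k g : ℝ → ℝ} {a x : ℝ} (hk : ∀ t ≤ 0, k t = 0)
    (hg : ∀ t ≤ a, g t = 0) (hx : a ≤ x) :
    (k ⋆[ContinuousLinearMap.mul ℝ ℝ, volume] g) x = ∫ t in a..x, k (x - t) * g t := by
  rw [convolution_mul_swap, intervalIntegral.integral_of_le hx,
    setIntegral_eq_integral_of_forall_compl_eq_zero]
  intro t ht
  rcases le_or_gt t a with h | h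
  · rw [hg t h, mul_zero]
  · rw [hk (x - t) (by linarith [not_le.1 fun h' => ht ⟨h, h'⟩]), zero_mul]

/-- The convolution of two functions vanishing on `(-∞, 0]` and `(-∞, a]` vanishes on
`(-∞, a]`. -/
lemma convolution_eq_zero_of_le {k g : ℝ → ℝ} {a x : ℝ} (hk : ∀ t ≤ 0, k t = 0)
    (hg : ∀ t ≤ a, g t = 0) (hx : x ≤ a) :
    (k ⋆[ContinuousLinearMap.mul ℝ ℝ, volume] g) x = 0 := by
  rw [convolution_mul_swap]
  refine integral_eq_zero_of_ae (Eventually.of_forall fun t => ?_)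
  rcases le_or_gt t a with h | h
  · simp [hg t h]
  · simp [hk (x - t) (by linarith)]

/-- Convolution of integrable real functions is associative almost everywhere. -/
lemma ae_convolution_assoc {f g k : ℝ → ℝ} (hf : Integrable f) (hg : Integrable g)
    (hk : Integrable k) :
    ∀ᵐ x, ((f ⋆[ContinuousLinearMap.mul ℝ ℝ, volume] g)
        ⋆[ContinuousLinearMap.mul ℝ ℝ, volume] k) x =
      (f ⋆[ContinuousLinearMap.mul ℝ ℝ, volume]
        (g ⋆[ContinuousLinearMap.mul ℝ ℝ, volume] k)) x := by
  filter_upwards [hf.norm.ae_convolution_exists (ContinuousLinearMap.mul ℝ ℝ)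
    (hg.norm.integrable_convolution (ContinuousLinearMap.mul ℝ ℝ) hk.norm)] with x hx
  exact convolution_assoc _ _ _ _ (fun x y z => mul_assoc x y z) hf.aestronglyMeasurable
    hg.aestronglyMeasurable hk.aestronglyMeasurable (hf.ae_convolution_exists _ hg)
    (hg.norm.ae_convolution_exists _ hk.norm) hx

/-- Interval integrals agree when the integrands agree on the open interval. -/
lemma intervalIntegral_congr_Ioo {f g : ℝ → ℝ} {a x : ℝ} (hx : a ≤ x)
    (h : ∀ t ∈ Ioo a x, f t = g t) : ∫ t in a..x, f t = ∫ t in a..x, g t := by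
  simp only [intervalIntegral.integral_of_le hx, integral_Ioc_eq_integral_Ioo]
  exact setIntegral_congr_fun measurableSet_Ioo h

/-- `D^ϑ_{a+} I^ϱ_{a+} φ = φ` a.e. for kernels satisfying the Sonin
condition: for `φ ∈ L¹(I)` one has `∫_a^x ϑ(x-t)(I^ϱ_{a+}φ)(t) dt = ∫_a^x φ(s) ds` for
a.e. `x ∈ I`, and the right-hand side is absolutely continuous with a.e. derivative `φ`. -/
theorem sonin_left_inverse
    (a b : ℝ) (ϱ ϑ : ℝ → ℝ)
    (hab : a < b)
    (hϱ1 : IntegrableOn ϱ (Ioo 0 (b - a)))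
    (hϑ1 : IntegrableOn ϑ (Ioo 0 (b - a)))
    (hson : SoninCond a b ϱ ϑ) :
    ∀ φ : ℝ → ℝ, IntegrableOn φ (Ioo a b) →
      (∀ᵐ x ∂(volume.restrict (Ioo a b)),
        (∫ t in a..x, ϑ (x - t) * (∫ s in a..t, ϱ (t - s) * φ s)) = ∫ s in a..x, φ s) ∧
      (∀ᵐ x ∂(volume.restrict (Ioo a b)),
        HasDerivAt (fun y => ∫ s in a..y, φ s) (φ x) x) := by
  intro φ hφ
  refine ⟨?_, ?_⟩
  · set R := (Ioo 0 (b - a)).indicator ϱ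
    set T := (Ioo 0 (b - a)).indicator ϑ
    set F := (Ioo a b).indicator φ
    have hRi : Integrable R := hϱ1.integrable_indicator measurableSet_Ioo
    have hTi : Integrable T := hϑ1.integrable_indicator measurableSet_Ioo
    have hFi : Integrable F := hφ.integrable_indicator measurableSet_Ioo
    have hR0 : ∀ t ≤ 0, R t = 0 := fun t ht => indicator_of_notMem (fun h => h.1.not_ge ht) _
    have hT0 : ∀ t ≤ 0, T t = 0 := fun t ht => indicator_of_notMem (fun h => h.1.not_ge ht) _
    have hF0 : ∀ t ≤ a, F t = 0 := fun t ht => indicator_of_notMem (fun h => h.1.not_ge ht) _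
    have hRe : ∀ t, 0 < t → t < b - a → R t = ϱ t :=
      fun t h h' => indicator_of_mem (mem_Ioo.2 ⟨h, h'⟩) _
    have hTe : ∀ t, 0 < t → t < b - a → T t = ϑ t :=
      fun t h h' => indicator_of_mem (mem_Ioo.2 ⟨h, h'⟩) _
    have hFe : ∀ t, a < t → t < b → F t = φ t :=
      fun t h h' => indicator_of_mem (mem_Ioo.2 ⟨h, h'⟩) _
    have hcomm : (T ⋆[ContinuousLinearMap.mul ℝ ℝ, volume] R) =
        R ⋆[ContinuousLinearMap.mul ℝ ℝ, volume] T := by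
      ext x
      rw [convolution_mul_swap, convolution_mul]
      simp only [mul_comm]
    have hTR : ∀ᵐ y, y ∈ Ioo 0 (b - a) →
        (T ⋆[ContinuousLinearMap.mul ℝ ℝ, volume] R) y = 1 := by
      filter_upwards [(ae_restrict_iff' measurableSet_Ioo).1 hson] with y hy hmem
      rw [hcomm, convolution_eq_intervalIntegral hR0 hT0 hmem.1.le, ← hy hmem]
      refine intervalIntegral_congr_Ioo hmem.1.le fun t ht => ?_
      rw [hRe _ (by linarith [ht.2]) (by linarith [ht.1, hmem.2]),
        hTe _ ht.1 (by linarith [ht.2, hmem.2])]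
    rw [ae_restrict_iff' measurableSet_Ioo]
    filter_upwards [ae_convolution_assoc hTi hRi hFi] with x hx hmem
    rw [convolution_eq_intervalIntegral (fun t ht => convolution_eq_zero_of_le hT0 hR0 ht) hF0
        hmem.1.le, convolution_eq_intervalIntegral hT0
        (fun t ht => convolution_eq_zero_of_le hR0 hF0 ht) hmem.1.le] at hx
    trans ∫ t in a..x, T (x - t) * (R ⋆[ContinuousLinearMap.mul ℝ ℝ, volume] F) t
    · refine intervalIntegral_congr_Ioo hmem.1.le fun t ht => ?_
      rw [hTe _ (by linarith [ht.2]) (by linarith [ht.1, hmem.2]),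
        convolution_eq_intervalIntegral hR0 hF0 ht.1.le]
      congr 1
      refine intervalIntegral_congr_Ioo ht.1.le fun s hs => ?_
      rw [hRe _ (by linarith [hs.2]) (by linarith [hs.1, ht.2, hmem.2]),
        hFe _ hs.1 (by linarith [hs.2, ht.2, hmem.2])]
    · rw [← hx]
      simp only [intervalIntegral.integral_of_le hmem.1.le, integral_Ioc_eq_integral_Ioo]
      refine setIntegral_congr_ae measurableSet_Ioo ?_
      filter_upwards [(quasiMeasurePreserving_sub_left_of_right_invariant volume x).ae hTR]
        with t ht htm
      rw [ht ⟨by linarith [htm.2], by linarith [htm.1, hmem.2]⟩, one_mul,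
        hFe _ htm.1 (htm.2.trans hmem.2)]
  · have hi : IntervalIntegrable φ volume a b :=
      (intervalIntegrable_iff_integrableOn_Ioo_of_le hab.le).2 hφ
    rw [ae_restrict_iff' measurableSet_Ioo]
    filter_upwards [hi.ae_hasDerivAt_integral] with x hx hmem
    exact hx (uIcc_of_le hab.le ▸ Ioo_subset_Icc_self hmem) a left_mem_uIcc
end
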